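/- arXiv:1706.07462 — 2 statements merged into one kernel-verified Lean document; each statement's English description precedes it below -/
import Mathlib

section
/- Let μ be a monomial in R = K[x_1,…,x_n], let M be a monomial of degree d, let M' be the lexicographically latest degree-d monomial of Borel(M) dividing μ, and let m ∈ Borel(M) be a monomial dividing μ with m ≠ M'. If j is the largest index with σ_j(m) < σ_j(M'), then there exists an index i < j such that x_i divides m, (x_j/x_i)·m ∈ Borel(M'), and (x_j/x_i)·m divides μ. -/
/-!  Monomials in `K[x_1,…,x_n]` are identified with their exponent vectors in `Fin n → ℕ`
(`0`-based indexing: `x_1` corresponds to index `0`).  -/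

variable {n : ℕ}

/-- Cumulative exponent vector (`0`-based): `cexp m i = m i + m (i+1) + ⋯ + m (n-1)`,
so `cexp m i` is the paper's `σ_{i+1}(m)`, and `cexp m n = 0` is the convention
`σ_{n+1}(m) = 0`. -/
def cexp (m : Fin n → ℕ) (i : ℕ) : ℕ :=
  ∑ k : Fin n, if i ≤ (k : ℕ) then m k else 0

/-- `mshift m src tgt` is the exponent vector of `(x_tgt / x_src) · m` (only used when
`src ≠ tgt` and `x_src` divides `m`).  Thus `mshift m j i` is the Borel move `B_{j→i}(m)`
(for `i < j`) and `mshift m i j` is the reverse Borel move `RB_{i→j}(m)` (for `i < j`). -/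
def mshift (m : Fin n → ℕ) (src tgt : Fin n) : Fin n → ℕ :=
  fun k => if k = tgt then m tgt + 1 else if k = src then m src - 1 else m k

/-- `BorelStep a b` : `b` is obtained from `a` by a single Borel move `B_{j→i}`, `i < j`. -/
def BorelStep (a b : Fin n → ℕ) : Prop :=
  ∃ i j : Fin n, i < j ∧ 0 < a j ∧ b = mshift a j i

/-- `InBorel m m'` : `m ∈ Borel(m')`, i.e. `m` is obtained from `m'` by a finite (possibly
empty) sequence of Borel moves. -/
def InBorel (m m' : Fin n → ℕ) : Prop := Relation.ReflTransGen BorelStep m' m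

/-- Divisibility of monomials: `m` divides `μ`. -/
def mDvd (m μ : Fin n → ℕ) : Prop := ∀ k, m k ≤ μ k

/-- `mLexLt m m'` : `m` is lexicographically smaller than `m'` (lex order with
`x_1 > x_2 > ⋯ > x_n`); i.e. `m` comes *later* than `m'` in the lex listing of monomials. -/
def mLexLt (m m' : Fin n → ℕ) : Prop :=
  ∃ i : Fin n, (∀ k, k < i → m k = m' k) ∧ m i < m' i

/-- Total degree of a monomial. -/
def mDeg (m : Fin n → ℕ) : ℕ := ∑ k, m k

theorem cexp_succ' (m : Fin n → ℕ) (k : Fin n) : cexp m k = m k + cexp m (k + 1) := by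
  have h : m k = ∑ t : Fin n, if t = k then m t else 0 := by simp
  unfold cexp
  rw [h, ← Finset.sum_add_distrib]
  apply Finset.sum_congr rfl
  intro t _
  by_cases h1 : t = k
  · subst h1; simp
  · have : (t : ℕ) ≠ k := fun h => h1 (Fin.ext h)
    simp only [h1, if_false, zero_add]
    split_ifs <;> first | rfl | omega

theorem cexp_top (m : Fin n → ℕ) (i : ℕ) (h : n ≤ i) : cexp m i = 0 := by
  unfold cexp
  apply Finset.sum_eq_zero
  intro t _
  have := t.2
  rw [if_neg (by omega)]

theorem cexp_anti (m : Fin n → ℕ) {i k : ℕ} (h : i ≤ k) : cexp m k ≤ cexp m i := by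
  unfold cexp
  apply Finset.sum_le_sum
  intro t _
  split_ifs <;> omega

theorem cexp_const (m : Fin n → ℕ) {i k : ℕ} (h : i ≤ k)
    (hz : ∀ t : Fin n, i ≤ t → (t : ℕ) < k → m t = 0) : cexp m i = cexp m k := by
  unfold cexp
  apply Finset.sum_congr rfl
  intro t _
  have := hz t
  split_ifs <;> first | rfl | omega

theorem cexp_shift (m : Fin n → ℕ) (s t : Fin n) (hst : s ≠ t) (hs : 0 < m s) (i : ℕ) :
    cexp (mshift m s t) i + (if i ≤ (s : ℕ) then 1 else 0)
      = cexp m i + (if i ≤ (t : ℕ) then 1 else 0) := by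
  have e : ∀ r : Fin n, (if i ≤ (r : ℕ) then 1 else 0)
      = ∑ k : Fin n, if k = r then (if i ≤ (k : ℕ) then 1 else 0) else 0 := by
    intro r; simp
  rw [e s, e t]
  unfold cexp
  rw [← Finset.sum_add_distrib, ← Finset.sum_add_distrib]
  apply Finset.sum_congr rfl
  intro k _
  unfold mshift
  by_cases h1 : k = t
  · subst h1
    simp only [if_true, if_neg hst.symm]
    split_ifs <;> omega
  · by_cases h2 : k = s
    · subst h2
      simp only [if_true, if_neg hst]
      split_ifs <;> omega
    · simp [h1, h2]

theorem cexp_inj (a b : Fin n → ℕ) (h : ∀ i : ℕ, cexp a i = cexp b i) : a = b := by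
  funext k
  have h1 := cexp_succ' a k
  have h2 := cexp_succ' b k
  rw [h, h] at h1
  omega

theorem inBorel_cexp {a b : Fin n → ℕ} (h : InBorel a b) :
    (∀ i : ℕ, cexp a i ≤ cexp b i) ∧ cexp a 0 = cexp b 0 := by
  induction h with
  | refl => exact ⟨fun _ => le_rfl, rfl⟩
  | tail _ hs ih =>
    obtain ⟨i, j, hij, hpos, rfl⟩ := hs
    rename_i c _
    have hij' : (i : ℕ) < j := hij
    have hsh := cexp_shift c j i (ne_of_gt hij) hpos
    constructor
    · intro k
      have h1 := hsh k
      have h2 := ih.1 k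
      split_ifs at h1 <;> omega
    · have h1 := hsh 0
      have h2 := ih.2
      simp at h1
      omega

theorem exists_rev (a b : Fin n → ℕ) (h : ∀ i : ℕ, cexp a i ≤ cexp b i)
    (h0 : cexp a 0 = cexp b 0) (j : Fin n) (hj : cexp a j < cexp b j) :
    ∃ i : Fin n, i < j ∧ 0 < a i ∧ ∀ k : ℕ, cexp (mshift a i j) k ≤ cexp b k := by
  have hne : (Finset.univ.filter (fun i : Fin n => i < j ∧ 0 < a i)).Nonempty := by
    by_contra hcon
    rw [Finset.not_nonempty_iff_eq_empty, Finset.filter_eq_empty_iff] at hcon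
    have h1 := cexp_const a (Nat.zero_le j) (fun t _ ht => by
      have h3 := hcon (Finset.mem_univ t)
      have h4 : t < j := ht
      by_contra h5
      exact h3 ⟨h4, Nat.pos_of_ne_zero h5⟩)
    have h2 := cexp_anti b (Nat.zero_le j)
    omega
  obtain ⟨i, hi, himax⟩ := Finset.exists_max_image _ id hne
  simp only [Finset.mem_filter, Finset.mem_univ, true_and, id] at hi himax
  refine ⟨i, hi.1, hi.2, fun k => ?_⟩
  have hij : (i : ℕ) < j := hi.1
  have h1 := cexp_shift a i j (ne_of_lt hi.1) hi.2 k
  have h2 := h k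
  by_cases hk : (i : ℕ) < k ∧ k ≤ j
  · have h3 := cexp_const a hk.2 (fun t ht1 ht2 => by
      by_contra h5
      have h6 := himax t ⟨ht2, Nat.pos_of_ne_zero h5⟩
      have h7 : (t : ℕ) ≤ i := h6
      omega)
    have h4 := cexp_anti b hk.2
    split_ifs at h1 <;> omega
  · split_ifs at h1 <;> omega

theorem inBorel_of_cexp (b : Fin n → ℕ) (N : ℕ) : ∀ a : Fin n → ℕ,
    (∀ i : ℕ, cexp a i ≤ cexp b i) → cexp a 0 = cexp b 0 →
    (∑ k ∈ Finset.range n, (cexp b k - cexp a k) ≤ N) → InBorel a b := by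
  induction N with
  | zero =>
    intro a h h0 hN
    have : a = b := by
      apply cexp_inj
      intro i
      by_cases hi : i < n
      · have h1 : ∑ k ∈ Finset.range n, (cexp b k - cexp a k) = 0 := by omega
        rw [Finset.sum_eq_zero_iff] at h1
        have := h1 i (Finset.mem_range.2 hi)
        have := h i
        omega
      · rw [cexp_top _ _ (by omega), cexp_top _ _ (by omega)]
    subst this
    exact Relation.ReflTransGen.refl
  | succ N ih =>
    intro a h h0 hN
    by_cases hj : ∃ j : Fin n, cexp a j < cexp b j
    · obtain ⟨j, hj⟩ := hj
      obtain ⟨i, hij, hpos, hle⟩ := exists_rev a b h h0 j hj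
      have hij' : (i : ℕ) < j := hij
      have hsh := cexp_shift a i j (ne_of_lt hij) hpos
      have hb : InBorel (mshift a i j) b := by
        apply ih _ hle
        · have := hsh 0
          simp at this
          omega
        · have : ∑ k ∈ Finset.range n, (cexp b k - cexp (mshift a i j) k)
              < ∑ k ∈ Finset.range n, (cexp b k - cexp a k) := by
            apply Finset.sum_lt_sum
            · intro k _
              have h1 := hsh k
              split_ifs at h1 <;> omega
            · refine ⟨j, Finset.mem_range.2 j.2, ?_⟩
              have h1 := hsh j
              split_ifs at h1 <;> omega
          omega
      refine Relation.ReflTransGen.tail hb ⟨i, j, hij, ?_, ?_⟩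
      · simp [mshift]
      · funext k
        unfold mshift
        by_cases h1 : k = i
        · subst h1
          simp [ne_of_lt hij]
          omega
        · by_cases h2 : k = j
          · subst h2; simp [h1]
          · simp [h1, h2]
    · push Not at hj
      apply ih a h h0
      rw [Finset.sum_eq_zero]
      · omega
      · intro k hk
        have := hj ⟨k, Finset.mem_range.1 hk⟩
        simp only at this
        omega

theorem inBorel_iff {a b : Fin n → ℕ} :
    InBorel a b ↔ (∀ i : ℕ, cexp a i ≤ cexp b i) ∧ cexp a 0 = cexp b 0 :=
  ⟨inBorel_cexp, fun h => inBorel_of_cexp b _ a h.1 h.2 le_rfl⟩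

/-- The join of two monomials with respect to the cumulative exponent vectors. -/
def bjoin (a b : Fin n → ℕ) : Fin n → ℕ := fun k =>
  max (cexp a k) (cexp b k) - max (cexp a (k + 1)) (cexp b (k + 1))

theorem cexp_bjoin (a b : Fin n → ℕ) (r : ℕ) : ∀ i : ℕ, n ≤ i + r →
    cexp (bjoin a b) i = max (cexp a i) (cexp b i) := by
  induction r with
  | zero =>
    intro i hi
    rw [cexp_top _ _ (by omega), cexp_top _ _ (by omega), cexp_top _ _ (by omega)]
    rfl
  | succ r ih =>
    intro i hi
    by_cases hn : n ≤ i
    · exact ih i (by omega)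
    · have h1 := cexp_succ' (bjoin a b) ⟨i, by omega⟩
      simp only [bjoin] at h1
      have h2 := ih (i + 1) (by omega)
      have h3 := cexp_anti a (Nat.le_succ i)
      have h4 := cexp_anti b (Nat.le_succ i)
      simp only [Nat.succ_eq_add_one] at h3 h4
      change cexp (bjoin a b) i = _ + cexp (bjoin a b) (i + 1) at h1
      omega

theorem cexp_split (a b : Fin n → ℕ) (i : ℕ) (h : ∀ k : Fin n, (k : ℕ) < i → a k = b k)
    (h0 : cexp a 0 = cexp b 0) (hi : i ≤ n) : cexp a i = cexp b i := by
  induction i with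
  | zero => exact h0
  | succ i ih =>
    have h1 := ih (fun k hk => h k (by omega)) (by omega)
    have h2 := cexp_succ' a ⟨i, by omega⟩
    have h3 := cexp_succ' b ⟨i, by omega⟩
    have h4 := h ⟨i, by omega⟩ (by simp)
    simp only at h2 h3
    omega

/-- With `M'` the lex-latest degree-`d` monomial of `Borel(M)` dividing `μ`,
let `m ∈ Borel(M)` divide `μ` with `m ≠ M'`, and let `j` be the largest index with
`σ_j(m) < σ_j(M')`.  Then there is an index `i < j` with `x_i` dividing `m`,
`(x_j/x_i)·m ∈ Borel(M')`, and `(x_j/x_i)·m` dividing `μ`. -/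
theorem statement8 (μ M M' m : Fin n → ℕ) (d : ℕ) (hMd : mDeg M = d)
    (hM'B : InBorel M' M) (hM'dvd : mDvd M' μ)
    (hlatest : ∀ w, InBorel w M → mDvd w μ → w ≠ M' → mLexLt M' w)
    (hm : InBorel m M) (hmdvd : mDvd m μ) (hne : m ≠ M')
    (j : Fin n) (hj : cexp m (j : ℕ) < cexp M' (j : ℕ))
    (hjmax : ∀ k : Fin n, j < k → ¬ cexp m (k : ℕ) < cexp M' (k : ℕ)) :
    ∃ i : Fin n, i < j ∧ 0 < m i ∧ InBorel (mshift m i j) M' ∧ mDvd (mshift m i j) μ := by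
  have hMc := inBorel_cexp hM'B
  have hmc := inBorel_cexp hm
  have hw : ∀ i : ℕ, cexp (bjoin m M') i = max (cexp m i) (cexp M' i) :=
    fun i => cexp_bjoin m M' n i (by omega)
  have hwB : InBorel (bjoin m M') M := by
    rw [inBorel_iff]
    refine ⟨fun i => ?_, ?_⟩
    · rw [hw]; exact max_le (hmc.1 i) (hMc.1 i)
    · rw [hw, hmc.2, hMc.2, max_self]
  have hwd : mDvd (bjoin m M') μ := by
    intro k
    have h1 := cexp_succ' m k
    have h2 := cexp_succ' M' k
    have h3 := hmdvd k
    have h4 := hM'dvd k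
    unfold bjoin
    omega
  have hwM : bjoin m M' = M' := by
    by_contra hcon
    obtain ⟨i, hi1, hi2⟩ := hlatest _ hwB hwd hcon
    have h0 : cexp M' 0 = cexp (bjoin m M') 0 := by
      rw [hw, hmc.2, hMc.2, max_self]
    have h1 := cexp_split M' (bjoin m M') i (fun k hk => hi1 k hk) h0 i.2.le
    have h2 := cexp_succ' M' i
    have h3 := cexp_succ' (bjoin m M') i
    have h4 := hw (i + 1)
    omega
  have hle : ∀ i : ℕ, cexp m i ≤ cexp M' i := by
    intro i
    have := hw i
    rw [hwM] at this
    omega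
  have h00 : cexp m 0 = cexp M' 0 := by rw [hmc.2, hMc.2]
  obtain ⟨i, hij, hpos, hk⟩ := exists_rev m M' hle h00 j hj
  refine ⟨i, hij, hpos, ?_, ?_⟩
  · rw [inBorel_iff]
    refine ⟨hk, ?_⟩
    have := cexp_shift m i j (ne_of_lt hij) hpos 0
    simp at this
    omega
  · have h1 := cexp_succ' m j
    have h2 := cexp_succ' M' j
    have h3 : cexp M' (j + 1) ≤ cexp m (j + 1) := by
      by_cases hn : (j : ℕ) + 1 < n
      · have h5 : j < (⟨j + 1, hn⟩ : Fin n) := by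
          rw [Fin.lt_def]; simp
        exact not_lt.1 (hjmax ⟨j + 1, hn⟩ h5)
      · rw [cexp_top _ _ (by omega)]; omega
    intro k
    have h4 := hM'dvd k
    have h5 := hmdvd k
    unfold mshift
    split_ifs with h6 h7
    · subst h6; omega
    · subst h7; omega
    · exact h5
end

section
/- Let I = Borel(M_1,…,M_k) with M_1,…,M_k monomials of degree d, let μ be a monomial, and suppose for each i that some monomial of Borel(M_i) divides μ; let M'_i be the lexicographically latest degree-d monomial of Borel(M_i) dividing μ, and set I' = Borel(M'_1,…,M'_k). Then the fiber graphs of I and of I' at μ coincide: Γ_μ(I) = Γ_μ(I'). -/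
/-!  Monomials in `K[x_1,…,x_n]` are identified with their exponent vectors in `Fin n → ℕ`
(`0`-based indexing: `x_1` corresponds to index `0`).  -/

variable {n : ℕ}

/-- A vertex of the fiber graph `Γ_μ(I)`, where `G` is the minimal monomial generating set of
`I`: a multiset of elements of `G` whose product (sum of exponent vectors) is `μ`. -/
def FiberVertex (G : Set (Fin n → ℕ)) (μ : Fin n → ℕ) (Z : Multiset (Fin n → ℕ)) : Prop :=
  (∀ w ∈ Z, w ∈ G) ∧ Z.sum = μ

/-- Adjacency in the fiber graph `Γ_μ(I)`: `Z` is obtained from `Z'` by applying a Borel move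
`B_{j→i}` to one element and the corresponding reverse Borel move `RB_{i→j}` to another,
leaving all other elements unchanged. -/
def FiberAdj (G : Set (Fin n → ℕ)) (μ : Fin n → ℕ) (Z Z' : Multiset (Fin n → ℕ)) : Prop :=
  FiberVertex G μ Z ∧ FiberVertex G μ Z' ∧
  ∃ (W : Multiset (Fin n → ℕ)) (u v u' v' : Fin n → ℕ) (i j : Fin n),
    i < j ∧ Z = u ::ₘ v ::ₘ W ∧ Z' = u' ::ₘ v' ::ₘ W ∧
    0 < u' j ∧ u = mshift u' j i ∧ 0 < v' i ∧ v = mshift v' i j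

/-- prefix sums -/
def psum (m : Fin n → ℕ) (l : ℕ) : ℕ := ∑ k : Fin n, if (k : ℕ) < l then m k else 0

theorem psum_zero (m : Fin n → ℕ) : psum m 0 = 0 := by simp [psum]

theorem psum_succ (m : Fin n → ℕ) (a : Fin n) : psum m (a + 1) = psum m a + m a := by
  have h : m a = ∑ k : Fin n, if k = a then m k else 0 := by simp
  rw [h, psum, psum, ← Finset.sum_add_distrib]
  refine Finset.sum_congr rfl fun k _ => ?_
  have := @Fin.ext_iff n k a
  grind

theorem psum_ge (m : Fin n → ℕ) (l : ℕ) (h : n ≤ l) : psum m l = mDeg m := by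
  refine Finset.sum_congr rfl fun k _ => ?_
  have := k.isLt
  rw [if_pos (by omega)]

theorem psum_mshift (m : Fin n → ℕ) (s t : Fin n) (hst : s ≠ t) (hs : 0 < m s) (l : ℕ) :
    psum (mshift m s t) l + (if (s : ℕ) < l then 1 else 0)
      = psum m l + (if (t : ℕ) < l then 1 else 0) := by
  have h : ∀ c : Fin n, (if (c : ℕ) < l then 1 else 0)
      = ∑ k : Fin n, if k = c then (if (k : ℕ) < l then 1 else 0) else 0 := by
    intro c; simp
  rw [h s, h t, psum, psum, ← Finset.sum_add_distrib, ← Finset.sum_add_distrib]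
  refine Finset.sum_congr rfl fun k _ => ?_
  simp only [mshift]
  split_ifs <;> subst_vars <;> first | omega | simp_all

theorem psum_cross (f g : Fin n → ℕ) (hd : mDeg f = mDeg g) (h : ∃ i, psum f i < psum g i) :
    ∃ a b : Fin n, a < b ∧ f a < g a ∧ g b < f b ∧
      ∀ l : ℕ, (a : ℕ) < l → l ≤ b → psum f l < psum g l := by
  classical
  obtain ⟨i, hi, hmin⟩ : ∃ i, psum f i < psum g i ∧ ∀ j < i, psum g j ≤ psum f j :=
    ⟨Nat.find h, Nat.find_spec h, fun j hj => not_lt.1 (Nat.find_min h hj)⟩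
  have hin : i < n := by
    by_contra hc
    rw [psum_ge f i (by omega), psum_ge g i (by omega)] at hi
    omega
  have h2 : ∃ j, i < j ∧ psum g j ≤ psum f j :=
    ⟨n, hin, by rw [psum_ge f n le_rfl, psum_ge g n le_rfl]; omega⟩
  obtain ⟨j, hij, hj, hjmin⟩ : ∃ j, i < j ∧ psum g j ≤ psum f j ∧
      ∀ l < j, i < l → psum f l < psum g l :=
    ⟨Nat.find h2, (Nat.find_spec h2).1, (Nat.find_spec h2).2, fun l hl hil => by
      by_contra hc
      exact Nat.find_min h2 hl ⟨hil, not_lt.1 hc⟩⟩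
  have hjn : j ≤ n := by
    by_contra hc
    have := hjmin n (by omega) hin
    rw [psum_ge f n le_rfl, psum_ge g n le_rfl] at this
    omega
  obtain ⟨a, rfl⟩ : ∃ a, i = a + 1 := by
    cases i with
    | zero => simp [psum_zero] at hi
    | succ a => exact ⟨a, rfl⟩
  obtain ⟨b, rfl⟩ : ∃ b, j = b + 1 := ⟨j - 1, by omega⟩
  have hlt : ∀ l : ℕ, a < l → l ≤ b → psum f l < psum g l := by
    intro l h1 h2
    rcases Nat.lt_or_ge (a + 1) l with h3 | h3
    · exact hjmin l (by omega) h3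
    · obtain rfl : l = a + 1 := by omega
      exact hi
  refine ⟨⟨a, by omega⟩, ⟨b, by omega⟩, by simp; omega, ?_, ?_, hlt⟩
  · have e1 := psum_succ f ⟨a, by omega⟩
    have e2 := psum_succ g ⟨a, by omega⟩
    have := hmin a (by omega)
    simp only at e1 e2
    omega
  · have e1 := psum_succ f ⟨b, by omega⟩
    have e2 := psum_succ g ⟨b, by omega⟩
    have := hlt b (by omega) le_rfl
    simp only at e1 e2
    omega

theorem mDeg_mshift (m : Fin n → ℕ) (s t : Fin n) (hst : s ≠ t) (hs : 0 < m s) :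
    mDeg (mshift m s t) = mDeg m := by
  have := psum_mshift m s t hst hs n
  rw [psum_ge _ n le_rfl, psum_ge _ n le_rfl] at this
  simpa using this

theorem inBorel_necessary {m M : Fin n → ℕ} (h : InBorel m M) :
    mDeg m = mDeg M ∧ ∀ l, psum M l ≤ psum m l := by
  unfold InBorel at h
  induction h with
  | refl => exact ⟨rfl, fun _ => le_rfl⟩
  | tail _ hs ih =>
    obtain ⟨i, j, hij, hj, rfl⟩ := hs
    refine ⟨(mDeg_mshift _ _ _ hij.ne' hj).trans ih.1, fun l => ?_⟩
    have h1 := ih.2 l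
    have h2 := psum_mshift _ j i hij.ne' hj l
    have h3 : (i : ℕ) < j := hij
    split_ifs at h2 <;> omega

theorem inBorel_sufficient (m : Fin n → ℕ) : ∀ (N : ℕ) (M : Fin n → ℕ),
    (∑ l ∈ Finset.range (n + 1), (psum m l - psum M l)) = N →
    mDeg m = mDeg M → (∀ l, psum M l ≤ psum m l) → InBorel m M := by
  intro N
  induction N using Nat.strong_induction_on with
  | _ N ih =>
    intro M hN hd hle
    by_cases h : ∃ i, psum M i < psum m i
    · obtain ⟨a, b, hab, h1, h2, h3⟩ := psum_cross M m hd.symm h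
      have hb : 0 < M b := by omega
      have hab' : (a : ℕ) < b := hab
      have hps := psum_mshift M b a hab.ne' hb
      have key : ∀ l, psum M l ≤ psum (mshift M b a) l ∧ psum (mshift M b a) l ≤ psum m l := by
        intro l
        have e1 := hps l
        have e2 := hle l
        have e3 := h3 l
        split_ifs at e1 <;> omega
      refine Relation.ReflTransGen.head ⟨a, b, hab, hb, rfl⟩ ?_
      refine ih _ ?_ (mshift M b a) rfl (hd.trans (mDeg_mshift M b a hab.ne' hb).symm)
        fun l => (key l).2
      rw [← hN]
      refine Finset.sum_lt_sum (fun l _ => ?_) ⟨b, ?_, ?_⟩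
      · have := key l
        omega
      · simp
      · have e1 := hps b
        have e3 := h3 b hab' le_rfl
        simp [hab'] at e1
        omega
    · push Not at h
      have : M = m := by
        funext a
        have e1 := psum_succ M a
        have e2 := psum_succ m a
        have e3 := h a
        have e4 := h (a + 1)
        have e5 := hle a
        have e6 := hle (a + 1)
        omega
      subst this
      exact Relation.ReflTransGen.refl

theorem inBorel_latest {M p μ : Fin n → ℕ} (hB : InBorel p M) (hdvd : mDvd p μ)
    (hl : ∀ m, InBorel m M → mDvd m μ → m ≠ p → mLexLt p m)
    {w : Fin n → ℕ} (hw : InBorel w M) (hwd : mDvd w μ) : InBorel w p := by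
  obtain ⟨d1, l1⟩ := inBorel_necessary hB
  obtain ⟨d2, l2⟩ := inBorel_necessary hw
  refine inBorel_sufficient w _ p rfl (d2.trans d1.symm) ?_
  by_contra hc
  push Not at hc
  obtain ⟨a, b, hab, h1, h2, h3⟩ := psum_cross w p (d2.trans d1.symm) hc
  have ha : 0 < p a := by omega
  have hab' : (a : ℕ) < b := hab
  have hqa : mshift p a b a = p a - 1 := by simp [mshift, hab.ne]
  have hlow : ∀ k, k < a → mshift p a b k = p k := by
    intro k hk
    simp [mshift, hk.ne, (hk.trans hab).ne]
  have hq : InBorel (mshift p a b) M := by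
    refine inBorel_sufficient _ _ M rfl ((mDeg_mshift p a b hab.ne ha).trans d1) fun l => ?_
    have e1 := psum_mshift p a b hab.ne ha l
    have e2 := l1 l
    have e3 := l2 l
    have e4 := h3 l
    split_ifs at e1 <;> omega
  have hqd : mDvd (mshift p a b) μ := by
    intro k
    have e1 := hdvd k
    have e2 := hwd k
    simp only [mshift]
    split_ifs <;> subst_vars <;> omega
  have hne : mshift p a b ≠ p := by
    intro h
    rw [h] at hqa
    omega
  obtain ⟨i, hi1, hi2⟩ := hl _ hq hqd hne
  rcases lt_trichotomy i a with h | h | h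
  · rw [hlow i h] at hi2
    omega
  · subst h
    omega
  · have := hi1 a h
    omega

/-- Let `I = Borel(M_1,…,M_k)` with each `M_i` of degree `d` (so the
minimal monomial generating set of `I` is `{w | ∃ i, w ∈ Borel(M_i)}`), let `μ` be a
monomial such that for each `i` some monomial of `Borel(M_i)` divides `μ`, let `M'_i` be
the lex-latest degree-`d` monomial of `Borel(M_i)` dividing `μ`, and set
`I' = Borel(M'_1,…,M'_k)`.  Then `Γ_μ(I) = Γ_μ(I')`: the two fiber graphs have the same
vertices and the same edges. -/
theorem statement10 (k d : ℕ) (Ms Ms' : Fin k → Fin n → ℕ) (μ : Fin n → ℕ)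
    (hdeg : ∀ i, mDeg (Ms i) = d)
    (hB : ∀ i, InBorel (Ms' i) (Ms i))
    (hdvd : ∀ i, mDvd (Ms' i) μ)
    (hlatest : ∀ i m, InBorel m (Ms i) → mDvd m μ → m ≠ Ms' i → mLexLt (Ms' i) m) :
    (∀ Z, FiberVertex {w | ∃ i, InBorel w (Ms i)} μ Z ↔
          FiberVertex {w | ∃ i, InBorel w (Ms' i)} μ Z) ∧
    (∀ Z Z', FiberAdj {w | ∃ i, InBorel w (Ms i)} μ Z Z' ↔
             FiberAdj {w | ∃ i, InBorel w (Ms' i)} μ Z Z') := by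
  have hv : ∀ Z, FiberVertex {w | ∃ i, InBorel w (Ms i)} μ Z ↔
          FiberVertex {w | ∃ i, InBorel w (Ms' i)} μ Z := by
    intro Z
    constructor
    · rintro ⟨h1, h2⟩
      refine ⟨fun w hw => ?_, h2⟩
      obtain ⟨i, hi⟩ := h1 w hw
      refine ⟨i, inBorel_latest (hB i) (hdvd i) (hlatest i) hi ?_⟩
      have : w ≤ Z.sum := Multiset.single_le_sum (fun x _ => zero_le) w hw
      rw [h2] at this
      exact this
    · rintro ⟨h1, h2⟩
      refine ⟨fun w hw => ?_, h2⟩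
      obtain ⟨i, hi⟩ := h1 w hw
      exact ⟨i, Relation.ReflTransGen.trans (hB i) hi⟩
  refine ⟨hv, fun Z Z' => ?_⟩
  unfold FiberAdj
  rw [hv Z, hv Z']
end
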